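/- For every NPLCS N, location q and sets of locations A, B ⊆ Q, let P = {p ∈ Q : there is a finite-memory scheduler W with Pr_W((p,ε) ⊨ □◇A ∧ □¬B) > 0} (where ¬B denotes the set Q∖B of locations outside B). Then there exists a finite-memory scheduler U with Pr_U((q,ε) ⊨ □◇A ∧ ◇□¬B) > 0 if and only if there exists a finite-memory scheduler V with Pr_V((q,ε) ⊨ ◇P) > 0. -/

import Mathlib

open scoped ENNReal
open Classical

namespace NPLCSmodel

/-! ## Lossy channel systems -/

/-- Operations of a lossy channel system: send a message on a channel,
receive a message from a channel, or an internal action. -/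
inductive LcsOp (C M : Type) : Type where
  | send : C → M → LcsOp C M
  | recv : C → M → LcsOp C M
  | internal : LcsOp C M

def LcsOp.IsRecv {C M : Type} : LcsOp C M → Prop
  | .recv _ _ => True
  | _ => False

/-- A transition rule `src --op--> dst`. -/
structure LcsRule (Q C M : Type) : Type where
  src : Q
  op : LcsOp C M
  dst : Q

/-- Channel contents: a word over `M` for each channel. -/
abbrev Chans (C M : Type) : Type := C → List M

/-- Configurations: a location together with channel contents. -/
abbrev Conf (Q C M : Type) : Type := Q × Chans C M

/-- The empty channel contents ε. -/
def eps (C M : Type) : Chans C M := fun _ => []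

variable {Q C M : Type}

/-- When is an operation possible on channel contents `w`? -/
def enabledOp : LcsOp C M → Chans C M → Prop
  | .recv c m, w => ∃ v, w c = m :: v
  | .send _ _, _ => True
  | .internal, _ => True

/-- Effect of an operation on the channel contents (for a perfect step). -/
def applyOp [DecidableEq C] : LcsOp C M → Chans C M → Chans C M
  | .send c m, w => Function.update w c (w c ++ [m])
  | .recv c _, w => Function.update w c (w c).tail
  | .internal, w => w

/-- A rule is enabled in a configuration. -/
def LcsRule.EnabledIn (δ : LcsRule Q C M) (s : Conf Q C M) : Prop :=
  δ.src = s.1 ∧ enabledOp δ.op s.2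

/-- A lossy channel system `L = (Q, C, M, Δ)` (the finiteness of the location,
channel and message types is imposed by `Fintype` assumptions at use sites):
a finite set of transition rules such that every location has at least one
outgoing rule that is not a receive. -/
structure LCS (Q C M : Type) : Type where
  rules : Set (LcsRule Q C M)
  finiteRules : rules.Finite
  noDeadlock : ∀ q : Q, ∃ δ ∈ rules, δ.src = q ∧ ¬ δ.op.IsRecv

variable [DecidableEq C]

/-- Lossy step via rule `δ`: a perfect step followed by losing arbitrarily
many messages (`<+` is the (componentwise) subword relation). -/
def LCS.StepVia (L : LCS Q C M) (s : Conf Q C M) (δ : LcsRule Q C M)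
    (t : Conf Q C M) : Prop :=
  δ ∈ L.rules ∧ δ.EnabledIn s ∧ t.1 = δ.dst ∧ ∀ c, List.Sublist (t.2 c) (applyOp δ.op s.2 c)

/-- Lossy step `s → t`. -/
def LCS.Step (L : LCS Q C M) (s t : Conf Q C M) : Prop := ∃ δ, L.StepVia s δ t

/-- Reachability `s →* t`. -/
def LCS.Reach (L : LCS Q C M) : Conf Q C M → Conf Q C M → Prop :=
  Relation.ReflTransGen L.Step

/-- Constrained reachability `s →*_[X) t`: all configurations along the path,
except possibly the last one, have their location in `X`. -/
def LCS.ReachWithin (L : LCS Q C M) (X : Set Q) : Conf Q C M → Conf Q C M → Prop :=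
  Relation.ReflTransGen (fun a b => L.Step a b ∧ a.1 ∈ X)

/-- Constrained reachability `s →*_[X] t`: all configurations along the path,
including `s` and `t`, have their location in `X`. -/
def LCS.ReachConstrained (L : LCS Q C M) (X : Set Q) (s t : Conf Q C M) : Prop :=
  L.ReachWithin X s t ∧ t.1 ∈ X

/-- `X` is safe for `A`. -/
def LCS.IsSafeFor (L : LCS Q C M) (A X : Set Q) : Prop :=
  X ⊆ A ∧ ∀ x ∈ X, ∃ t, L.Step (x, eps C M) t ∧ t.1 ∈ X

/-- `Safe(A)`: the largest set safe for `A` (the union of all such sets). -/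
def LCS.Safe (L : LCS Q C M) (A : Set Q) : Set Q := ⋃₀ {X | L.IsSafeFor A X}

/-- `X` is promising for `A`. -/
def LCS.IsPromisingFor (L : LCS Q C M) (A X : Set Q) : Prop :=
  ∀ x ∈ X, ∃ t, L.ReachWithin X (x, eps C M) t ∧ t.1 ∈ A

/-- `Prom(A)`: the largest set promising for `A` (the union of all such sets). -/
def LCS.Prom (L : LCS Q C M) (A : Set Q) : Set Q := ⋃₀ {X | L.IsPromisingFor A X}

/-! ## NPLCS and the induced Markov decision process -/

/-- An NPLCS: an LCS together with a fault rate `τ ∈ (0,1)`. -/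
structure NPLCS (Q C M : Type) : Type where
  L : LCS Q C M
  τ : ℝ
  τ_pos : 0 < τ
  τ_lt_one : τ < 1

/-- The number of embeddings of the second list as a subword of the first. -/
def countEmb [DecidableEq M] : List M → List M → ℕ
  | _, [] => 1
  | [], _ :: _ => 0
  | a :: v, b :: w => (if a = b then countEmb v w else 0) + countEmb v (b :: w)

variable [Fintype C] [DecidableEq M]

/-- Total number of messages in the channels. -/
def chansSize (w : Chans C M) : ℕ := ∑ c, (w c).length

/-- `P_lost(v,v') = τ^(|v|-|v'|) · (1-τ)^|v'| · C(v,v')`, the probability that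
channel contents `v` become `v'` through message losses. -/
noncomputable def plost (τ : ℝ) (v v' : Chans C M) : ℝ≥0∞ :=
  ENNReal.ofReal
    (τ ^ (chansSize v - chansSize v') * (1 - τ) ^ chansSize v' *
      (∏ c, countEmb (v c) (v' c) : ℕ))

/-- One-step probability `P_N(s, δ, t)` of the MDP of an NPLCS. -/
noncomputable def NPLCS.stepProb (N : NPLCS Q C M) (s : Conf Q C M)
    (δ : LcsRule Q C M) (t : Conf Q C M) : ℝ≥0∞ :=
  if δ ∈ N.L.rules ∧ δ.EnabledIn s ∧ t.1 = δ.dst then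
    plost N.τ (applyOp δ.op s.2) t.2
  else 0

/-! ## Probability measure of a countable-state Markov chain

Given one-step probabilities `k` on a state space `S`, the measure of a set of
trajectories is the Carathéodory outer measure generated by the probabilities
of cylinder sets; it agrees with the usual Markov-chain measure on all
measurable (in particular, on all ω-regular) sets of trajectories. -/

section Chain
variable {S : Type}

/-- Probability that the chain starting in `s` performs the finite sequence
of steps through the configurations listed in `l`. -/
noncomputable def chainPathProb (k : S → S → ℝ≥0∞) : S → List S → ℝ≥0∞
  | _, [] => 1
  | s, t :: l => k s t * chainPathProb k t l

/-- The cylinder of trajectories starting with `s` followed by `l`. -/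
def chainCyl (s : S) (l : List S) : Set (ℕ → S) :=
  {ω | ω 0 = s ∧ ∀ (i : ℕ) (h : i < l.length), ω (i + 1) = l.get ⟨i, h⟩}

/-- Premeasure: probability of a cylinder set, `∞` on other (nonempty) sets. -/
noncomputable def chainFun (k : S → S → ℝ≥0∞) (s : S) (A : Set (ℕ → S)) : ℝ≥0∞ :=
  if A = ∅ then 0 else ⨅ (l : List S) (_ : A = chainCyl s l), chainPathProb k s l

theorem chainFun_empty (k : S → S → ℝ≥0∞) (s : S) : chainFun k s ∅ = 0 := by
  simp [chainFun]

/-- The probability, for the Markov chain with one-step probabilities `k`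
started in `s`, of the set `E` of trajectories (paths starting in `s`). -/
noncomputable def chainPr (k : S → S → ℝ≥0∞) (s : S) (E : Set (ℕ → S)) : ℝ≥0∞ :=
  MeasureTheory.OuterMeasure.ofFunction (chainFun k s) (chainFun_empty k s)
    (E ∩ {ω | ω 0 = s})

end Chain

/-! ## Schedulers -/

/-- A (history-dependent, deterministic) scheduler: given the history
`h = s₁ → ⋯ → s_{n-1}` and the current configuration `sₙ`, it chooses a
transition rule of `N` enabled in `sₙ`. -/
structure Scheduler (N : NPLCS Q C M) : Type where
  choose : List (Conf Q C M) → Conf Q C M → LcsRule Q C M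
  choose_mem : ∀ h s, choose h s ∈ N.L.rules
  choose_enabled : ∀ h s, (choose h s).EnabledIn s

variable {N : NPLCS Q C M}

/-- The Markov chain `MC_U` induced by a scheduler: its states are finite
paths, represented as (history, current configuration). -/
noncomputable def Scheduler.kernel (U : Scheduler N) :
    List (Conf Q C M) × Conf Q C M → List (Conf Q C M) × Conf Q C M → ℝ≥0∞ :=
  fun a b =>
    if b.1 = a.1 ++ [a.2] then N.stepProb a.2 (U.choose a.1 a.2) b.2 else 0

/-- `Pr_U(s ⊨ E)`: the probability, under scheduler `U` with starting
configuration `s`, of the set `E` of infinite paths (trajectories of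
configurations). -/
noncomputable def Scheduler.Pr (U : Scheduler N) (s : Conf Q C M)
    (E : Set (ℕ → Conf Q C M)) : ℝ≥0∞ :=
  chainPr U.kernel ([], s) {ω | (fun i => (ω i).2) ∈ E}

/-- Memoryless scheduler: the decision depends only on the current
configuration. -/
def Scheduler.Memoryless (U : Scheduler N) : Prop :=
  ∀ h h' s, U.choose h s = U.choose h' s

/-- Blind scheduler: the decision depends only on the sequence of locations
that have been visited. -/
def Scheduler.Blind (U : Scheduler N) : Prop :=
  ∀ h h' s s', h.map Prod.fst = h'.map Prod.fst → s.1 = s'.1 →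
    U.choose h s = U.choose h' s'

/-- Finite-memory scheduler data: finitely many modes, a starting mode, a
decision rule and a next-mode function. -/
structure FMScheduler (N : NPLCS Q C M) : Type 1 where
  Mode : Type
  modeFin : Fintype Mode
  init : Mode
  D : Mode → Conf Q C M → LcsRule Q C M
  upd : Mode → Conf Q C M → Mode
  D_mem : ∀ u s, D u s ∈ N.L.rules
  D_enabled : ∀ u s, (D u s).EnabledIn s

/-- A scheduler is finite-memory if it is induced by finite-memory data. -/
def Scheduler.FiniteMemory (U : Scheduler N) : Prop :=
  ∃ fm : FMScheduler N, ∀ h s, U.choose h s = fm.D (h.foldl fm.upd fm.init) s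

/-- The Markov chain `MC_U` of a finite-memory scheduler: states are pairs
`s_u` of a configuration `s` and a mode `u`. -/
noncomputable def FMScheduler.kernel (fm : FMScheduler N) :
    Conf Q C M × fm.Mode → Conf Q C M × fm.Mode → ℝ≥0∞ :=
  fun a b =>
    if b.2 = fm.upd a.2 a.1 then N.stepProb a.1 (fm.D a.2 a.1) b.1 else 0

/-- Probability measure of the Markov chain `MC_U` of a finite-memory
scheduler, over trajectories of (configuration, mode) states. -/
noncomputable def FMScheduler.PrMC (fm : FMScheduler N)
    (a : Conf Q C M × fm.Mode) (E : Set (ℕ → Conf Q C M × fm.Mode)) : ℝ≥0∞ :=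
  chainPr fm.kernel a E

/-- Reachability in the Markov chain `MC_U` of a finite-memory scheduler. -/
def FMScheduler.MCReach (fm : FMScheduler N) :
    Conf Q C M × fm.Mode → Conf Q C M × fm.Mode → Prop :=
  Relation.ReflTransGen (fun a b => 0 < fm.kernel a b)

/-- The history (the first `i` configurations) of a trajectory. -/
def histTo (ω : ℕ → Conf Q C M) (i : ℕ) : List (Conf Q C M) :=
  (List.range i).map ω

/-- Almost blind scheduler: there are a scheduler `W` and a blind scheduler
`V` such that from any starting configuration, almost surely the choices of
`U` along the path agree with those of `W` up to some finite time and with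
those of `V` afterwards. -/
def Scheduler.AlmostBlind (U : Scheduler N) : Prop :=
  ∃ W V : Scheduler N, V.Blind ∧ ∀ s : Conf Q C M,
    U.Pr s {ω | ∃ n : ℕ,
      (∀ i ≤ n, U.choose (histTo ω i) (ω i) = W.choose (histTo ω i) (ω i)) ∧
      (∀ i, n < i → U.choose (histTo ω i) (ω i) = V.choose (histTo ω i) (ω i))} = 1

/-! ## LTL-style events on trajectories -/

/-- `□P` -/
def evAlways {α : Type} (P : α → Prop) : Set (ℕ → α) := {ω | ∀ i, P (ω i)}

/-- `◇P` -/
def evEventually {α : Type} (P : α → Prop) : Set (ℕ → α) := {ω | ∃ i, P (ω i)}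

/-- `□◇P` -/
def evInfOften {α : Type} (P : α → Prop) : Set (ℕ → α) :=
  {ω | ∀ n, ∃ i, n ≤ i ∧ P (ω i)}

/-- `◇□P` -/
def evEvAlways {α : Type} (P : α → Prop) : Set (ℕ → α) :=
  {ω | ∃ n, ∀ i, n ≤ i → P (ω i)}

/-- The atomic proposition "the current location belongs to `A`". -/
def inLoc (A : Set Q) : Conf Q C M → Prop := fun s => s.1 ∈ A


section ChainLemmas

variable {S S' : Type}

theorem chainPr_mono (k : S → S → ℝ≥0∞) (s : S) {E F : Set (ℕ → S)}
    (h : ∀ ω ∈ E, ω 0 = s → ω ∈ F) : chainPr k s E ≤ chainPr k s F :=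
  MeasureTheory.measure_mono fun ω hω => ⟨h ω hω.1 hω.2, hω.2⟩

theorem ofFunction_chainCyl_le (k : S → S → ℝ≥0∞) (s : S) (l : List S) :
    MeasureTheory.OuterMeasure.ofFunction (chainFun k s) (chainFun_empty k s) (chainCyl s l)
      ≤ chainPathProb k s l := by
  refine (MeasureTheory.OuterMeasure.ofFunction_le _).trans ?_
  unfold chainFun
  split_ifs
  · exact zero_le
  · exact (iInf_le _ l).trans (iInf_le _ rfl)

theorem chainPr_le_one (k : S → S → ℝ≥0∞) (s : S) (E : Set (ℕ → S)) : chainPr k s E ≤ 1 :=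
  (MeasureTheory.measure_mono fun ω hω => by
    exact ⟨hω.2, fun i h => absurd h (Nat.not_lt_zero i)⟩).trans (ofFunction_chainCyl_le k s [])

theorem chainPr_eq_zero_of_countable {ι : Type} [Countable ι] (k : S → S → ℝ≥0∞) (s : S)
    {E : Set (ℕ → S)} (F : ι → Set (ℕ → S)) (h : ∀ ω ∈ E, ω 0 = s → ∃ i, ω ∈ F i)
    (h0 : ∀ i, chainPr k s (F i) = 0) : chainPr k s E = 0 := by
  refine MeasureTheory.measure_mono_null (t := ⋃ i, F i ∩ {ω | ω 0 = s}) ?_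
    (MeasureTheory.measure_iUnion_null h0)
  intro ω hω
  obtain ⟨i, hi⟩ := h ω hω.1 hω.2
  exact Set.mem_iUnion.2 ⟨i, hi, hω.2⟩

theorem chainPathProb_ofFn (k : S → S → ℝ≥0∞) (n : ℕ) (ω : ℕ → S) :
    chainPathProb k (ω 0) (List.ofFn fun j : Fin n => ω (j + 1))
      = ∏ j ∈ Finset.range n, k (ω j) (ω (j + 1)) := by
  induction n generalizing ω with
  | zero => simp [chainPathProb]
  | succ n ih =>
    rw [List.ofFn_succ, chainPathProb, Finset.prod_range_succ']
    have := ih fun i => ω (i + 1)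
    simp only [Fin.val_succ, Fin.val_zero, zero_add] at this ⊢
    rw [this, mul_comm]

theorem chainPathProb_map (k : S → S → ℝ≥0∞) (k' : S' → S' → ℝ≥0∞) (f : S → S')
    (hk : ∀ a b, k' (f a) (f b) = k a b) (s : S) (l : List S) :
    chainPathProb k' (f s) (l.map f) = chainPathProb k s l := by
  induction l generalizing s with
  | nil => rfl
  | cons a l ih => simp [chainPathProb, hk, ih]

/-- Almost surely, all steps of a trajectory have positive probability. -/
theorem chainPr_zero_step [Countable S] (k : S → S → ℝ≥0∞) (s : S) :
    chainPr k s {ω | ∃ i, k (ω i) (ω (i + 1)) = 0} = 0 := by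
  refine chainPr_eq_zero_of_countable k s
    (ι := {l : List S // chainPathProb k s l = 0}) (fun l => chainCyl s l.1) ?_ ?_
  · rintro ω ⟨i, hi⟩ h0
    refine ⟨⟨List.ofFn fun j : Fin (i + 1) => ω (j + 1), ?_⟩, h0, ?_⟩
    · rw [← h0, chainPathProb_ofFn]
      exact Finset.prod_eq_zero (Finset.self_mem_range_succ i) hi
    · intro j hj
      simp only [List.get_ofFn, Fin.val_cast]
  · rintro ⟨l, hl⟩
    exact le_antisymm (((MeasureTheory.measure_mono Set.inter_subset_left).trans
      (ofFunction_chainCyl_le k s l)).trans hl.le) zero_le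

/-- Prepend the state `s` to the image of a trajectory under `f`. -/
def consMap (s : S') (f : S → S') (ω : ℕ → S) : ℕ → S'
  | 0 => s
  | i + 1 => f (ω i)

theorem mul_chainPr_le (k : S → S → ℝ≥0∞) (k' : S' → S' → ℝ≥0∞) (f : S → S')
    (hf : Function.Injective f) (hk : ∀ a b, k' (f a) (f b) = k a b) (s : S') (t : S)
    (h1 : k' s (f t) ≤ 1) {X : Set (ℕ → S)} {Y : Set (ℕ → S')}
    (h : ∀ ω ∈ X, ω 0 = t → consMap s f ω ∈ Y) :
    k' s (f t) * chainPr k t X ≤ chainPr k' s Y := by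
  set O := MeasureTheory.OuterMeasure.ofFunction (chainFun k t) (chainFun_empty k t) with hO
  set μ := k' s (f t) • MeasureTheory.OuterMeasure.map (consMap s f)
    (MeasureTheory.OuterMeasure.restrict {ω | ω 0 = t} O) with hμ
  have hμa : ∀ A, μ A = k' s (f t) * O (consMap s f ⁻¹' A ∩ {ω | ω 0 = t}) := by
    intro A
    simp [hμ]
  have key : μ ≤ MeasureTheory.OuterMeasure.ofFunction (chainFun k' s) (chainFun_empty k' s) := by
    rw [MeasureTheory.OuterMeasure.le_ofFunction]
    intro A
    unfold chainFun
    split_ifs with hA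
    · simp [hA]
    refine le_iInf₂ fun l hl => ?_
    rw [hμa]
    subst hl
    cases l with
    | nil =>
      refine mul_le_one' h1 ?_
      exact chainPr_le_one k t _
    | cons b l =>
      rcases Set.eq_empty_or_nonempty (consMap s f ⁻¹' (chainCyl s (b :: l)) ∩ {ω | ω 0 = t})
        with he | ⟨ω, ⟨-, hω⟩, hω0⟩
      · simp [he]
      have hb : b = f t := by
        have := hω 0 (by simp)
        simpa [consMap, show ω 0 = t from hω0] using this.symm
      have hl : l = (List.ofFn fun j : Fin l.length => ω (j + 1)).map f := by
        apply List.ext_get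
        · simp
        · intro n h1 h2
          have := hω (n + 1) (by simpa using h1)
          simpa [consMap] using this.symm
      rw [chainPathProb, hb]
      gcongr
      conv_rhs => rw [hl, chainPathProb_map k k' f hk]
      refine le_trans (MeasureTheory.measure_mono ?_) (ofFunction_chainCyl_le k t _)
      rintro ω' ⟨⟨-, hω'⟩, h0⟩
      refine ⟨h0, fun i hi => ?_⟩
      simp only [List.length_ofFn] at hi
      have h2 := hω' (i + 1) (by simpa using hi)
      have h3 := hω (i + 1) (by simpa using hi)
      simpa using hf (h2.trans h3.symm)
  refine le_trans ?_ ((key _).trans (MeasureTheory.measure_mono (le_refl _)))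
  rw [hμa]
  gcongr
  refine MeasureTheory.measure_mono ?_
  rintro ω ⟨hX, h0⟩
  exact ⟨⟨h ω hX h0, rfl⟩, h0⟩

theorem chainPr_le_mul (k : S → S → ℝ≥0∞) (k' : S' → S' → ℝ≥0∞) (f : S → S')
    (hk : ∀ a b, k' (f a) (f b) = k a b) (s : S') (t : S)
    (hc : k' s (f t) ≠ ∞) {X : Set (ℕ → S)} {Y : Set (ℕ → S')}
    (h : ∀ ω ∈ Y, ω 0 = s → ∃ ω' ∈ X, ω' 0 = t ∧ ω = consMap s f ω') :
    chainPr k' s Y ≤ k' s (f t) * chainPr k t X := by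
  set O := MeasureTheory.OuterMeasure.ofFunction (chainFun k' s) (chainFun_empty k' s) with hO
  have hcyl : ∀ l, O (consMap s f '' chainCyl t l) ≤ k' s (f t) * chainPathProb k t l := by
    intro l
    rw [← chainPathProb_map k k' f hk]
    refine le_trans (MeasureTheory.measure_mono ?_) (ofFunction_chainCyl_le k' s (f t :: l.map f))
    rintro _ ⟨ω, ⟨h0, hω⟩, rfl⟩
    refine ⟨rfl, ?_⟩
    rintro (_ | i) hi
    · simp [consMap, h0]
    · have := hω i (by simpa using hi)
      simp [consMap, this]
  have hsub : Y ∩ {ω | ω 0 = s} ⊆ consMap s f '' (X ∩ {ω | ω 0 = t}) := by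
    rintro ω ⟨hY, h0⟩
    obtain ⟨ω', hX, h0', rfl⟩ := h ω hY h0
    exact ⟨ω', ⟨hX, h0'⟩, rfl⟩
  by_cases hc0 : k' s (f t) = 0
  · rw [hc0, zero_mul]
    refine (MeasureTheory.measure_mono (hsub.trans (Set.image_mono ?_))).trans
      ((hcyl []).trans (by rw [hc0, zero_mul]))
    rintro ω ⟨-, h0⟩
    exact ⟨h0, fun i hi => absurd hi (Nat.not_lt_zero i)⟩
  have key : MeasureTheory.OuterMeasure.comap (consMap s f) O ≤
      k' s (f t) • MeasureTheory.OuterMeasure.ofFunction (chainFun k t) (chainFun_empty k t) := by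
    rw [MeasureTheory.OuterMeasure.smul_ofFunction hc, MeasureTheory.OuterMeasure.le_ofFunction]
    intro A
    rw [MeasureTheory.OuterMeasure.comap_apply, Pi.smul_apply, smul_eq_mul]
    unfold chainFun
    split_ifs with hA
    · simp [hA]
    rw [ENNReal.mul_iInf_of_ne hc0 hc]
    refine le_iInf fun l => ?_
    rw [ENNReal.mul_iInf_of_ne hc0 hc]
    refine le_iInf fun hl => ?_
    rw [hl]
    exact hcyl l
  exact (MeasureTheory.measure_mono hsub).trans (key _)

end ChainLemmas

set_option linter.unusedSectionVars false

section LossProbabilities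

theorem countEmb_eq_count (v w : List M) : countEmb v w = v.sublists'.count w := by
  induction v generalizing w with
  | nil =>
    cases w with
    | nil => simp [countEmb]
    | cons b w => simp [countEmb]
  | cons a v ih =>
    rw [List.sublists'_cons, List.count_append]
    cases w with
    | nil =>
      have h0 : List.count ([] : List M) (List.map (List.cons a) v.sublists') = 0 := by
        rw [List.count_eq_zero]; simp
      rw [h0, ← ih]
      cases v <;> simp [countEmb]
    | cons b w =>
      rw [countEmb, ih, ih, add_comm]
      congr 1
      split_ifs with h
      · subst h
        rw [List.count_map_of_injective _ _ (List.cons_injective)]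
      · symm
        rw [List.count_eq_zero]
        simp [h]

theorem sum_sublists'_pow (x y : ℝ) (v : List M) :
    (v.sublists'.map fun w => x ^ (v.length - w.length) * y ^ w.length).sum
      = (x + y) ^ v.length := by
  induction v with
  | nil => simp
  | cons a v ih =>
    rw [List.sublists'_cons, List.map_append, List.sum_append, List.map_map, List.length_cons,
      pow_succ, ← ih, mul_add, ← List.sum_map_mul_right, ← List.sum_map_mul_right]
    congr 2
    · refine List.map_congr_left fun w hw => ?_
      have := (List.mem_sublists'.1 hw).length_le
      rw [Nat.succ_sub this, pow_succ]; ring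
    · refine List.map_congr_left fun w hw => ?_
      simp only [Function.comp_apply, List.length_cons, Nat.add_sub_add_right]
      ring

theorem sum_countEmb_pow (x y : ℝ) (v : List M) :
    ∑ w ∈ v.sublists'.toFinset, (countEmb v w : ℝ) * (x ^ (v.length - w.length) * y ^ w.length)
      = (x + y) ^ v.length := by
  rw [← sum_sublists'_pow, Finset.sum_list_map_count]
  simp only [countEmb_eq_count, nsmul_eq_mul]
  congr!

/-- The channel contents that can result from `v` by losing messages. -/
def subContents (v : Chans C M) : Finset (Chans C M) :=
  Fintype.piFinset fun c => (v c).sublists'.toFinset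

/-- The real number underlying `plost`. -/
noncomputable def realLost (τ : ℝ) (v v' : Chans C M) : ℝ :=
  τ ^ (chansSize v - chansSize v') * (1 - τ) ^ chansSize v' *
    (∏ c, countEmb (v c) (v' c) : ℕ)

theorem realLost_eq_zero (τ : ℝ) {v v' : Chans C M} (h : v' ∉ subContents v) :
    realLost τ v v' = 0 := by
  simp only [subContents, Fintype.mem_piFinset, not_forall] at h
  obtain ⟨c, hc⟩ := h
  have : ∏ c, countEmb (v c) (v' c) = 0 := by
    refine Finset.prod_eq_zero (Finset.mem_univ c) ?_
    rw [countEmb_eq_count, List.count_eq_zero]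
    simpa using hc
  simp [realLost, this]

theorem realLost_nonneg {τ : ℝ} (h0 : 0 < τ) (h1 : τ < 1) (v v' : Chans C M) :
    0 ≤ realLost τ v v' := by
  have := sub_pos.2 h1
  unfold realLost
  positivity

theorem realLost_mul_pow (τ x : ℝ) {v v' : Chans C M} (h : v' ∈ subContents v) :
    realLost τ v v' * x ^ chansSize v' = ∏ c, ((countEmb (v c) (v' c) : ℝ) *
      (τ ^ ((v c).length - (v' c).length) * ((1 - τ) * x) ^ (v' c).length)) := by
  have hle : ∀ c, (v' c).length ≤ (v c).length := by
    intro c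
    have := Fintype.mem_piFinset.1 h c
    simp only [List.mem_toFinset, List.mem_sublists'] at this
    exact this.length_le
  have hs : chansSize v - chansSize v' = ∑ c, ((v c).length - (v' c).length) := by
    rw [chansSize, chansSize, Finset.sum_tsub_distrib _ fun c _ => hle c]
  rw [Finset.prod_mul_distrib, Finset.prod_mul_distrib, Finset.prod_pow_eq_pow_sum,
    Finset.prod_pow_eq_pow_sum, realLost, hs, mul_pow]
  push_cast [chansSize]
  ring

theorem sum_realLost_mul_pow (τ x : ℝ) (v : Chans C M) :
    ∑ v' ∈ subContents v, realLost τ v v' * x ^ chansSize v'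
      = (τ + (1 - τ) * x) ^ chansSize v := by
  rw [Finset.sum_congr rfl fun v' h => realLost_mul_pow τ x h, subContents,
    ← Finset.prod_univ_sum (fun c => (v c).sublists'.toFinset)
      (fun c w => (countEmb (v c) w : ℝ) *
        (τ ^ ((v c).length - w.length) * ((1 - τ) * x) ^ w.length))]
  simp only [sum_countEmb_pow, Finset.prod_pow_eq_pow_sum, chansSize]

theorem sum_realLost (τ : ℝ) (v : Chans C M) : ∑ v' ∈ subContents v, realLost τ v v' = 1 := by
  simpa using sum_realLost_mul_pow τ 1 v

theorem eps_mem_subContents (v : Chans C M) : eps C M ∈ subContents v := by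
  simp [subContents, eps]

theorem chansSize_eps : chansSize (eps C M) = 0 := by
  simp [chansSize, eps]

theorem realLost_eps (τ : ℝ) (v : Chans C M) : realLost τ v (eps C M) = τ ^ chansSize v := by
  have : ∀ v : List M, countEmb v [] = 1 := fun v => by cases v <;> rfl
  simp [realLost, chansSize_eps, eps, this]

theorem realLost_le_one {τ : ℝ} (h0 : 0 < τ) (h1 : τ < 1) (v v' : Chans C M) :
    realLost τ v v' ≤ 1 := by
  by_cases h : v' ∈ subContents v
  · rw [← sum_realLost τ v]
    exact Finset.single_le_sum (f := realLost τ v) (fun w _ => realLost_nonneg h0 h1 v w) h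
  · rw [realLost_eq_zero τ h]; exact zero_le_one

theorem tsum_plost_mul {τ : ℝ} (h0 : 0 < τ) (h1 : τ < 1) (v : Chans C M) {g : Chans C M → ℝ}
    (hg : ∀ w, 0 ≤ g w) :
    ∑' w, plost τ v w * ENNReal.ofReal (g w)
      = ENNReal.ofReal (∑ w ∈ subContents v, realLost τ v w * g w) := by
  rw [ENNReal.ofReal_sum_of_nonneg fun w _ => mul_nonneg (realLost_nonneg h0 h1 v w) (hg w),
    tsum_eq_sum (s := subContents v)]
  · exact Finset.sum_congr rfl fun w _ => (ENNReal.ofReal_mul (realLost_nonneg h0 h1 v w)).symm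
  · intro w hw
    change ENNReal.ofReal (realLost τ v w) * _ = 0
    rw [realLost_eq_zero τ hw, ENNReal.ofReal_zero, zero_mul]

theorem chansSize_applyOp_le (op : LcsOp C M) (w : Chans C M) :
    chansSize (applyOp op w) ≤ chansSize w + 1 := by
  have key : ∀ (c : C) (l : List M), l.length ≤ (w c).length + 1 →
      chansSize (Function.update w c l) ≤ chansSize w + 1 := by
    intro c l hl
    unfold chansSize
    rw [← Finset.add_sum_erase _ _ (Finset.mem_univ c),
      ← Finset.add_sum_erase (a := c) _ (fun c => (w c).length) (Finset.mem_univ c),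
      Finset.sum_congr rfl fun d hd => by
        rw [Function.update_of_ne (Finset.ne_of_mem_erase hd)]]
    simp only [Function.update_self]
    omega
  cases op with
  | send c m => exact key c _ (by simp)
  | recv c m => exact key c _ (by simp; omega)
  | internal => exact Nat.le_succ _

/-- Constants for a geometric drift condition with the potential `2 ^ k + c`, `k` being the number
of messages, along paths that avoid empty channels. -/
theorem exists_drift_constants {τ : ℝ} (h0 : 0 < τ) (h1 : τ < 1) :
    ∃ c ρ : ℝ, 0 ≤ c ∧ 0 ≤ ρ ∧ ρ < 1 ∧ ∀ k n : ℕ, n ≤ k + 1 →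
      (2 - τ) ^ n + c * (1 - τ ^ n) ≤ ρ * (2 ^ k + c) := by
  have hlim : Filter.Tendsto (fun k : ℕ => (2 - τ) * ((2 - τ) / 2) ^ k) Filter.atTop
      (nhds ((2 - τ) * 0)) :=
    (tendsto_pow_atTop_nhds_zero_of_lt_one (by linarith) (by linarith)).const_mul _
  rw [mul_zero] at hlim
  obtain ⟨K, hK⟩ := Filter.eventually_atTop.1
    (hlim.eventually_le_const (show (0 : ℝ) < 1 / 4 by norm_num))
  set a : ℝ := τ ^ (K + 1) with ha
  set T : ℝ := 2 ^ (K + 1) with hT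
  have ha0 : 0 < a := by positivity
  have ha1 : a ≤ 1 := pow_le_one₀ h0.le h1.le
  have hT1 : 1 ≤ T := one_le_pow₀ (by norm_num)
  have hη : a / (8 * T) ≤ a / 8 := by
    apply div_le_div_of_nonneg_left ha0.le (by norm_num); linarith
  have hη0 : 0 < a / (8 * T) := by positivity
  set η := a / (8 * T) with hηd
  have hc0 : 0 < 2 * T / a := by positivity
  set c := 2 * T / a with hcd
  have hcη : c * η = 1 / 4 := by
    rw [hcd, hηd]; field_simp; norm_num
  have hca : c * a = 2 * T := by
    rw [hcd]; field_simp
  refine ⟨c, 1 - η, hc0.le, by linarith, by linarith, fun k n hn => ?_⟩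
  have hβ : (2 - τ) ^ n ≤ (2 - τ) ^ (k + 1) := pow_le_pow_right₀ (by linarith) hn
  have hτn : τ ^ (k + 1) ≤ τ ^ n := pow_le_pow_of_le_one h0.le h1.le hn
  have hpk : (1 : ℝ) ≤ 2 ^ k := one_le_pow₀ (by norm_num)
  have hτc := mul_le_mul_of_nonneg_left hτn hc0.le
  rcases le_or_gt K k with hk | hk
  · have h := hK k hk
    rw [div_pow] at h
    have h2 : (2 - τ) ^ (k + 1) ≤ 2 ^ k / 4 := by
      have : (2 - τ) * ((2 - τ) ^ k / 2 ^ k) = (2 - τ) ^ (k + 1) / 2 ^ k := by ring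
      rw [this, div_le_iff₀ (by positivity)] at h
      linarith
    have hτ0 : 0 ≤ c * τ ^ (k + 1) := by positivity
    have : η * 2 ^ k ≤ 1 / 8 * 2 ^ k := by gcongr; linarith
    nlinarith
  · have h2 : (2 - τ) ^ (k + 1) ≤ T :=
      (pow_le_pow_left₀ (by linarith) (by linarith) _).trans
        (pow_le_pow_right₀ (by norm_num) (by omega))
    have h3 : a ≤ τ ^ (k + 1) := pow_le_pow_of_le_one h0.le h1.le (by omega)
    have h4 := mul_le_mul_of_nonneg_left h3 hc0.le
    have h5 : 0 ≤ (1 - η) * 2 ^ k := mul_nonneg (by linarith) (by positivity)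
    nlinarith

end LossProbabilities

section Schedulers

theorem NPLCS.stepProb_le_one (N : NPLCS Q C M) (s : Conf Q C M) (δ : LcsRule Q C M)
    (t : Conf Q C M) : N.stepProb s δ t ≤ 1 := by
  unfold NPLCS.stepProb
  split_ifs
  · exact ENNReal.ofReal_le_one.2 (realLost_le_one N.τ_pos N.τ_lt_one _ _)
  · exact zero_le

/-- All messages are lost with positive probability. -/
theorem NPLCS.stepProb_eps_pos {s t : Conf Q C M} {δ : LcsRule Q C M}
    (h : 0 < N.stepProb s δ t) : 0 < N.stepProb s δ (t.1, eps C M) := by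
  unfold NPLCS.stepProb at h ⊢
  split_ifs at h with h1
  · rw [if_pos h1]
    refine ENNReal.ofReal_pos.2 ?_
    change 0 < realLost _ _ _
    rw [realLost_eps]
    exact pow_pos N.τ_pos _
  · exact absurd h (lt_irrefl 0)

/-- The scheduler `U` after the history `[s]`. -/
def Scheduler.after (U : Scheduler N) (s : Conf Q C M) : Scheduler N where
  choose h := U.choose (s :: h)
  choose_mem h := U.choose_mem (s :: h)
  choose_enabled h := U.choose_enabled (s :: h)

theorem Scheduler.FiniteMemory.after {U : Scheduler N} (hU : U.FiniteMemory) (s : Conf Q C M) :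
    (U.after s).FiniteMemory := by
  obtain ⟨fm, h⟩ := hU
  exact ⟨{ fm with init := fm.upd fm.init s }, fun l t => h (s :: l) t⟩

/-- The scheduler that uses the first decision of `V` and then behaves like `U`. -/
def Scheduler.firstThen (V U : Scheduler N) : Scheduler N where
  choose
    | [], s => V.choose [] s
    | _ :: h, s => U.choose h s
  choose_mem
    | [], s => V.choose_mem [] s
    | _ :: h, s => U.choose_mem h s
  choose_enabled
    | [], s => V.choose_enabled [] s
    | _ :: h, s => U.choose_enabled h s

theorem Scheduler.FiniteMemory.firstThen (V : Scheduler N) {U : Scheduler N}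
    (hU : U.FiniteMemory) : (V.firstThen U).FiniteMemory := by
  obtain ⟨fm, h⟩ := hU
  have := fm.modeFin
  let fm' : FMScheduler N :=
    { Mode := Option fm.Mode
      modeFin := inferInstance
      init := none
      D := fun u s => u.elim (V.choose [] s) fun u => fm.D u s
      upd := fun u s => some (u.elim fm.init fun u => fm.upd u s)
      D_mem := by
        rintro (_ | u) s
        · exact V.choose_mem [] s
        · exact fm.D_mem u s
      D_enabled := by
        rintro (_ | u) s
        · exact V.choose_enabled [] s
        · exact fm.D_enabled u s }
  have hfold : ∀ (l : List (Conf Q C M)) (u : fm.Mode),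
      l.foldl fm'.upd (some u) = some (l.foldl fm.upd u) := by
    intro l
    induction l with
    | nil => exact fun _ => rfl
    | cons a l ih => exact fun u => ih _
  refine ⟨fm', ?_⟩
  rintro (_ | ⟨a, l⟩) s
  · rfl
  · change U.choose l s = fm'.D (l.foldl fm'.upd (some fm.init)) s
    rw [hfold, h]
    rfl

/-- The trajectory starting in `s` and continuing as `ω`. -/
def consPath (s : Conf Q C M) (ω : ℕ → Conf Q C M) : ℕ → Conf Q C M
  | 0 => s
  | i + 1 => ω i

theorem Scheduler.kernel_cons (U : Scheduler N) (s : Conf Q C M)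
    (a b : List (Conf Q C M) × Conf Q C M) :
    U.kernel (s :: a.1, a.2) (s :: b.1, b.2) = (U.after s).kernel a b := by
  simp [Scheduler.kernel, Scheduler.after]

theorem Scheduler.kernel_first (U : Scheduler N) (s t : Conf Q C M) :
    U.kernel ([], s) ([s], t) = N.stepProb s (U.choose [] s) t := by
  simp [Scheduler.kernel]

theorem Scheduler.Pr_mono (U : Scheduler N) (s : Conf Q C M) {E F : Set (ℕ → Conf Q C M)}
    (h : ∀ ω ∈ E, ω 0 = s → ω ∈ F) : U.Pr s E ≤ U.Pr s F :=
  chainPr_mono _ _ fun ω hω h0 => h (fun i => (ω i).2) hω (by simp [h0])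

theorem Scheduler.Pr_le_one (U : Scheduler N) (s : Conf Q C M) (E : Set (ℕ → Conf Q C M)) :
    U.Pr s E ≤ 1 :=
  chainPr_le_one _ _ _

theorem Scheduler.exists_Pr_pos {ι : Type} [Countable ι] {U : Scheduler N} {s : Conf Q C M}
    {E : Set (ℕ → Conf Q C M)} (hE : 0 < U.Pr s E) (F : ι → Set (ℕ → Conf Q C M))
    (h : ∀ ω ∈ E, ω 0 = s → ∃ i, ω ∈ F i) : ∃ i, 0 < U.Pr s (F i) := by
  by_contra! hF
  refine hE.ne' (chainPr_eq_zero_of_countable _ _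
    (fun i => {ω | (fun j => (ω j).2) ∈ F i}) (fun ω hω h0 => ?_)
    fun i => le_antisymm (hF i) zero_le)
  exact h (fun i => (ω i).2) hω (by simp [h0])

/-- Lower bound for the probability of an event by conditioning on the first step. -/
theorem Scheduler.stepProb_mul_Pr_le (U : Scheduler N) (s t : Conf Q C M)
    {E F : Set (ℕ → Conf Q C M)} (h : ∀ ω ∈ E, consPath s ω ∈ F) :
    N.stepProb s (U.choose [] s) t * (U.after s).Pr t E ≤ U.Pr s F := by
  rw [← U.kernel_first]
  refine mul_chainPr_le (U.after s).kernel U.kernel (fun a => (s :: a.1, a.2)) ?_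
    (U.kernel_cons s) ([], s) ([], t) ?_ ?_
  · rintro ⟨a, b⟩ ⟨a', b'⟩ h
    simpa using h
  · change U.kernel ([], s) ([s], t) ≤ 1
    rw [U.kernel_first]
    exact N.stepProb_le_one _ _ _
  · intro ω hω _
    have := h _ hω
    change (fun i => (consMap ([], s) (fun a => (s :: a.1, a.2)) ω i).2) ∈ F
    convert this using 1
    funext i
    cases i <;> rfl

/-- Upper bound for the probability of an event by conditioning on the first step. -/
theorem Scheduler.Pr_le_tsum [Countable Q] [Countable M] (U : Scheduler N) (s : Conf Q C M)
    (F : Set (ℕ → Conf Q C M)) :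
    U.Pr s F ≤ ∑' t, N.stepProb s (U.choose [] s) t *
      (U.after s).Pr t {ω | consPath s ω ∈ F} := by
  set G : Set (ℕ → List (Conf Q C M) × Conf Q C M) :=
    {ω | ∀ i, U.kernel (ω i) (ω (i + 1)) ≠ 0} with hG
  set Y : Conf Q C M → Set (ℕ → List (Conf Q C M) × Conf Q C M) := fun t =>
    {ω | ω ∈ G ∧ (fun i => (ω i).2) ∈ F ∧ (ω 1).2 = t} with hY
  have hbad : chainPr U.kernel ([], s) Gᶜ = 0 := by
    rw [← nonpos_iff_eq_zero, ← chainPr_zero_step U.kernel ([], s)]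
    refine chainPr_mono _ _ fun ω hω _ => ?_
    simpa [hG] using hω
  have hsub : {ω | (fun i => (ω i).2) ∈ F} ∩ {ω | ω 0 = ([], s)} ⊆
      (Gᶜ ∩ {ω | ω 0 = ([], s)}) ∪ ⋃ t, (Y t ∩ {ω | ω 0 = ([], s)}) := by
    rintro ω ⟨hF, h0⟩
    by_cases hg : ω ∈ G
    · exact Or.inr (Set.mem_iUnion.2 ⟨(ω 1).2, ⟨hg, hF, rfl⟩, h0⟩)
    · exact Or.inl ⟨hg, h0⟩
  have h1 : U.Pr s F ≤ chainPr U.kernel ([], s) Gᶜ + ∑' t, chainPr U.kernel ([], s) (Y t) :=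
    (MeasureTheory.measure_mono hsub).trans ((MeasureTheory.measure_union_le _ _).trans
      (add_le_add le_rfl (MeasureTheory.measure_iUnion_le _)))
  rw [hbad, zero_add] at h1
  refine h1.trans (ENNReal.tsum_le_tsum fun t => ?_)
  rw [← U.kernel_first]
  refine chainPr_le_mul (U.after s).kernel U.kernel (fun a => (s :: a.1, a.2))
    (U.kernel_cons s) ([], s) ([], t) ?_ ?_
  · change U.kernel ([], s) ([s], t) ≠ ∞
    rw [U.kernel_first]
    exact ((N.stepProb_le_one _ _ _).trans_lt ENNReal.one_lt_top).ne
  rintro ω ⟨hg, hF, ht⟩ h0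
  have hstep : ∀ i, (ω (i + 1)).1 = (ω i).1 ++ [(ω i).2] := by
    intro i
    by_contra hne
    exact hg i (by simp [Scheduler.kernel, hne])
  have hhist : ∀ i, (ω (i + 1)).1 = s :: (ω (i + 1)).1.tail := by
    intro i
    induction i with
    | zero => simp [hstep 0, h0]
    | succ i ih => rw [hstep (i + 1), ih]; rfl
  refine ⟨fun i => ((ω (i + 1)).1.tail, (ω (i + 1)).2), ?_, ?_, ?_⟩
  · change consPath s _ ∈ F
    convert hF using 1
    funext i
    cases i with
    | zero => simp [consPath, h0]
    | succ i => rfl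
  · simp [hstep 0, h0, ht]
  · funext i
    cases i with
    | zero => exact h0
    | succ i => exact Prod.ext (hhist i) rfl

theorem Scheduler.exists_step_Pr_pos [Countable Q] [Countable M] {U : Scheduler N}
    {s : Conf Q C M} {F : Set (ℕ → Conf Q C M)} (h : 0 < U.Pr s F) :
    ∃ t, 0 < N.stepProb s (U.choose [] s) t ∧
      0 < (U.after s).Pr t {ω | consPath s ω ∈ F} := by
  by_contra! hF
  refine h.ne' (le_antisymm ((U.Pr_le_tsum s F).trans ?_) zero_le)
  refine (ENNReal.tsum_eq_zero.2 fun t => ?_).le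
  rcases eq_or_ne (N.stepProb s (U.choose [] s) t) 0 with h0 | h0
  · rw [h0, zero_mul]
  · rw [le_antisymm (hF t (pos_iff_ne_zero.2 h0)) zero_le, mul_zero]

/-- If a path under a finite-memory scheduler is in `x` at time `m` and satisfies `E` from then on
with positive probability, then some finite-memory scheduler satisfies `E` from `x` with positive
probability. -/
theorem Scheduler.exists_Pr_pos_of_shift [Countable Q] [Countable M] (E : Set (ℕ → Conf Q C M))
    (x : Conf Q C M) (m : ℕ) {U : Scheduler N} (hU : U.FiniteMemory) {s : Conf Q C M}
    (h : 0 < U.Pr s {ω | ω m = x ∧ (fun i => ω (m + i)) ∈ E}) :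
    ∃ W : Scheduler N, W.FiniteMemory ∧ 0 < W.Pr x E := by
  induction m generalizing U s with
  | zero =>
    refine ⟨U, hU, ?_⟩
    by_cases hs : s = x
    · rw [← hs]
      refine h.trans_le (U.Pr_mono s ?_)
      rintro ω ⟨-, hω⟩ -
      simpa using hω
    · refine absurd (h.trans_le (U.Pr_mono s (F := ∅) ?_)) ?_
      · rintro ω ⟨h1, -⟩ h2
        exact hs (h2.symm.trans h1)
      · rw [not_lt, Scheduler.Pr, chainPr]
        simp
  | succ m ih =>
    obtain ⟨t, -, ht⟩ := exists_step_Pr_pos h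
    refine ih (hU.after s) (ht.trans_le ((U.after s).Pr_mono t ?_))
    rintro ω ⟨h1, h2⟩ -
    refine ⟨h1, ?_⟩
    simpa only [Nat.add_right_comm m 1, consPath] using h2

/-- A potential that drifts to zero geometrically along paths avoiding empty channels. -/
noncomputable def potential (c : ℝ) (w : Chans C M) : ℝ :=
  if w = eps C M then 0 else 2 ^ chansSize w + c

theorem potential_nonneg {c : ℝ} (hc : 0 ≤ c) (w : Chans C M) : 0 ≤ potential c w := by
  unfold potential
  split_ifs <;> positivity

theorem sum_realLost_mul_potential_le {τ c : ℝ} (h0 : 0 < τ) (h1 : τ < 1)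
    (v : Chans C M) : ∑ w ∈ subContents v, realLost τ v w * potential c w
      ≤ (2 - τ) ^ chansSize v + c * (1 - τ ^ chansSize v) := by
  have h : ∑ w ∈ subContents v, realLost τ v w * potential c w
      + ∑ w ∈ subContents v, (if w = eps C M then realLost τ v w * c else 0)
      ≤ ∑ w ∈ subContents v, (realLost τ v w * 2 ^ chansSize w + realLost τ v w * c) := by
    rw [← Finset.sum_add_distrib]
    refine Finset.sum_le_sum fun w _ => ?_
    have := realLost_nonneg h0 h1 v w
    unfold potential
    split_ifs
    · rw [mul_zero, zero_add]
      exact le_add_of_nonneg_left (by positivity)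
    · rw [mul_add, add_zero]
  rw [Finset.sum_ite_eq' (subContents v) (eps C M), if_pos (eps_mem_subContents v), realLost_eps,
    Finset.sum_add_distrib, ← Finset.sum_mul, sum_realLost, sum_realLost_mul_pow] at h
  have e : τ + (1 - τ) * 2 = 2 - τ := by ring
  rw [e] at h
  linarith

theorem NPLCS.tsum_stepProb_mul_le (N : NPLCS Q C M) (s : Conf Q C M) (δ : LcsRule Q C M)
    (g : Chans C M → ℝ≥0∞) :
    ∑' t : Conf Q C M, N.stepProb s δ t * g t.2 ≤ ∑' w, plost N.τ (applyOp δ.op s.2) w * g w := by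
  rw [ENNReal.tsum_prod', tsum_eq_single δ.dst]
  · refine ENNReal.tsum_le_tsum fun w => ?_
    gcongr
    unfold NPLCS.stepProb
    split_ifs
    · exact le_rfl
    · exact zero_le
  · intro p hp
    refine ENNReal.tsum_eq_zero.2 fun w => ?_
    simp [NPLCS.stepProb, hp]

theorem Scheduler.Pr_avoid_eps_le [Countable Q] [Countable M] {c ρ : ℝ} (hc : 0 ≤ c) (hρ : 0 ≤ ρ)
    (hdrift : ∀ k n : ℕ, n ≤ k + 1 →
      (2 - N.τ) ^ n + c * (1 - N.τ ^ n) ≤ ρ * (2 ^ k + c))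
    (n : ℕ) (U : Scheduler N) (s : Conf Q C M) :
    U.Pr s {ω | ∀ i ≤ n, (ω i).2 ≠ eps C M} ≤ ENNReal.ofReal (ρ ^ n * potential c s.2) := by
  by_cases hs : s.2 = eps C M
  · refine (U.Pr_mono s (F := ∅) ?_).trans ?_
    · intro ω hω h
      exact hω 0 (Nat.zero_le n) (by rw [h, hs])
    · rw [Scheduler.Pr, chainPr]
      simp
  induction n generalizing U s with
  | zero =>
    refine (U.Pr_le_one _ _).trans (ENNReal.one_le_ofReal.2 ?_)
    rw [pow_zero, one_mul, potential, if_neg hs]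
    have : (1 : ℝ) ≤ 2 ^ chansSize s.2 := one_le_pow₀ (by norm_num)
    linarith
  | succ n ih =>
    have hstep : ∀ t : Conf Q C M,
        (U.after s).Pr t {ω | consPath s ω ∈ {ω | ∀ i ≤ n + 1, (ω i).2 ≠ eps C M}}
          ≤ ENNReal.ofReal (ρ ^ n * potential c t.2) := by
      intro t
      by_cases ht : t.2 = eps C M
      · refine ((U.after s).Pr_mono t (F := ∅) ?_).trans ?_
        · intro ω hω h
          exact hω 1 (by omega) (by rw [consPath, h, ht])
        · rw [Scheduler.Pr, chainPr]
          simp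
      · refine le_trans ((U.after s).Pr_mono t ?_) (ih (U.after s) t ht)
        intro ω hω _ i hi
        exact hω (i + 1) (by omega)
    refine (U.Pr_le_tsum s _).trans
      ((ENNReal.tsum_le_tsum fun t => mul_le_mul_right (hstep t) _).trans ?_)
    refine (N.tsum_stepProb_mul_le s _
      (fun w => ENNReal.ofReal (ρ ^ n * potential c w))).trans ?_
    rw [tsum_plost_mul N.τ_pos N.τ_lt_one _
      fun w => mul_nonneg (pow_nonneg hρ n) (potential_nonneg hc w)]
    refine ENNReal.ofReal_le_ofReal ?_
    simp only [mul_left_comm _ (ρ ^ n)]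
    rw [← Finset.mul_sum, pow_succ, mul_assoc, potential, if_neg hs]
    refine mul_le_mul_of_nonneg_left ?_ (pow_nonneg hρ n)
    exact (sum_realLost_mul_potential_le N.τ_pos N.τ_lt_one _).trans
      (hdrift _ _ (chansSize_applyOp_le _ _))

/-- Configurations with empty channels are almost surely visited. -/
theorem Scheduler.Pr_always_ne_eps [Countable Q] [Countable M] (U : Scheduler N)
    (s : Conf Q C M) : U.Pr s {ω | ∀ i, (ω i).2 ≠ eps C M} = 0 := by
  obtain ⟨c, ρ, hc, hρ, hρ1, hdrift⟩ := exists_drift_constants N.τ_pos N.τ_lt_one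
  have hlim : Filter.Tendsto (fun n : ℕ => ENNReal.ofReal (ρ ^ n * potential c s.2)) Filter.atTop
      (nhds (ENNReal.ofReal (0 * potential c s.2))) :=
    ENNReal.tendsto_ofReal ((tendsto_pow_atTop_nhds_zero_of_lt_one hρ hρ1).mul_const _)
  rw [zero_mul, ENNReal.ofReal_zero] at hlim
  refine le_antisymm (ge_of_tendsto' hlim fun n => ?_) zero_le
  refine le_trans (U.Pr_mono s ?_) (U.Pr_avoid_eps_le hc hρ hdrift n s)
  exact fun ω hω _ i _ => hω i

/-- Configurations with empty channels are almost surely visited infinitely often. -/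
theorem Scheduler.Pr_evEvAlways_ne_eps [Countable Q] [Countable M] {U : Scheduler N}
    (hU : U.FiniteMemory) (s : Conf Q C M) :
    U.Pr s (evEvAlways fun t => t.2 ≠ eps C M) = 0 := by
  by_contra h
  obtain ⟨⟨n, x⟩, hnx⟩ := exists_Pr_pos (pos_iff_ne_zero.2 h)
    (ι := ℕ × Conf Q C M)
    (fun p => {ω | ω p.1 = p.2 ∧ (fun i => ω (p.1 + i)) ∈ {ω | ∀ i, (ω i).2 ≠ eps C M}})
    (by
      rintro ω ⟨n, hn⟩ -
      exact ⟨(n, ω n), rfl, fun i => hn _ (Nat.le_add_right n i)⟩)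
  obtain ⟨W, -, hW⟩ := exists_Pr_pos_of_shift _ x n hU hnx
  exact hW.ne' (W.Pr_always_ne_eps x)

/-- If with positive probability `V` is in `P` at time `n`, and from all `(p, ε)` with `p ∈ P` a
finite-memory scheduler satisfies the eventual property `F` with positive probability, then so
does a finite-memory scheduler from the starting configuration. -/
theorem Scheduler.exists_finiteMemory_of_reach [Countable Q] [Countable M] (P : Set Q)
    (F : Set (ℕ → Conf Q C M)) (hF : ∀ s, ∀ ω ∈ F, consPath s ω ∈ F)
    (hP : ∀ p ∈ P, ∃ W : Scheduler N, W.FiniteMemory ∧ 0 < W.Pr (p, eps C M) F)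
    (n : ℕ) (V : Scheduler N) (s : Conf Q C M) (hs : n = 0 → s.2 = eps C M)
    (h : 0 < V.Pr s {ω | (ω n).1 ∈ P}) :
    ∃ U : Scheduler N, U.FiniteMemory ∧ 0 < U.Pr s F := by
  have hzero : ∀ (V : Scheduler N) (s : Conf Q C M),
      0 < V.Pr s {ω | (ω 0).1 ∈ P} → s.1 ∈ P := by
    intro V s h
    by_contra hsP
    refine absurd (h.trans_le (V.Pr_mono s (F := ∅) ?_)) ?_
    · intro ω h1 h2
      exact hsP (by rw [← h2]; exact h1)
    · rw [not_lt, Scheduler.Pr, chainPr]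
      simp
  induction n generalizing V s with
  | zero =>
    have := hP s.1 (hzero V s h)
    rwa [← hs rfl] at this
  | succ n ih =>
    obtain ⟨t, ht, ht'⟩ := exists_step_Pr_pos h
    obtain ⟨t', ht0, U, hU, hUt⟩ : ∃ t', 0 < N.stepProb s (V.choose [] s) t' ∧
        ∃ U : Scheduler N, U.FiniteMemory ∧ 0 < U.Pr t' F := by
      cases n with
      | zero => exact ⟨_, NPLCS.stepProb_eps_pos ht, hP t.1 (hzero (V.after s) t ht')⟩
      | succ n => exact ⟨t, ht, ih (V.after s) t (fun h => absurd h n.succ_ne_zero) ht'⟩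
    refine ⟨V.firstThen U, hU.firstThen V, ?_⟩
    refine lt_of_lt_of_le (ENNReal.mul_pos ht0.ne' hUt.ne')
      ((V.firstThen U).stepProb_mul_Pr_le s t' (hF s))

end Schedulers

/-- With `P` the set of locations `p` from which some finite-memory scheduler
satisfies `□◇A ∧ □¬B` with positive probability: a finite-memory scheduler
satisfies `□◇A ∧ ◇□¬B` with positive probability from `(q,ε)` iff a
finite-memory scheduler satisfies `◇P` with positive probability. -/
theorem statement15 {Q C M : Type} [Fintype Q] [Fintype C] [DecidableEq C]
    [Fintype M] [DecidableEq M] (N : NPLCS Q C M) (q : Q) (A B : Set Q) :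
    (∃ U : Scheduler N, U.FiniteMemory ∧
        0 < U.Pr (q, eps C M)
          (evInfOften (inLoc A) ∩ evEvAlways (fun s : Conf Q C M => s.1 ∉ B)))
    ↔ (∃ V : Scheduler N, V.FiniteMemory ∧
        0 < V.Pr (q, eps C M) (evEventually (inLoc
          {p : Q | ∃ W : Scheduler N, W.FiniteMemory ∧
            0 < W.Pr (p, eps C M)
              (evInfOften (inLoc A) ∩
                evAlways (fun s : Conf Q C M => s.1 ∉ B))}))) := by
  constructor
  · rintro ⟨U, hU, h⟩
    obtain ⟨i, hi⟩ := Scheduler.exists_Pr_pos h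
      (ι := Option (ℕ × Q))
      (fun o => o.elim (evEvAlways fun t => t.2 ≠ eps C M) fun p =>
        {ω | ω p.1 = (p.2, eps C M) ∧ (fun i => ω (p.1 + i)) ∈
          (evInfOften (inLoc A) ∩ evAlways (fun s : Conf Q C M => s.1 ∉ B))})
      (by
        rintro ω ⟨h1, n, hn⟩ -
        by_cases he : ω ∈ evEvAlways fun t : Conf Q C M => t.2 ≠ eps C M
        · exact ⟨none, he⟩
        · simp only [evEvAlways, Set.mem_ofPred_eq, not_exists, not_forall, not_not] at he
          obtain ⟨m, hm, hε⟩ := he n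
          refine ⟨some (m, (ω m).1), Prod.ext rfl hε, fun k => ?_, fun i => hn _ (by omega)⟩
          obtain ⟨i, hi, hA⟩ := h1 (m + k)
          exact ⟨i - m, by omega, by simpa [Nat.add_sub_cancel' (show m ≤ i by omega)] using hA⟩)
    rcases i with _ | ⟨m, p⟩
    · exact absurd (Scheduler.Pr_evEvAlways_ne_eps hU _) hi.ne'
    · refine ⟨U, hU, hi.trans_le (U.Pr_mono _ ?_)⟩
      rintro ω ⟨hω, -⟩ -
      refine ⟨m, ?_⟩
      rw [hω]
      exact Scheduler.exists_Pr_pos_of_shift _ _ m hU hi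
  · rintro ⟨V, -, h⟩
    obtain ⟨n, hn⟩ := Scheduler.exists_Pr_pos h (fun n => {ω | (ω n).1 ∈
      {p : Q | ∃ W : Scheduler N, W.FiniteMemory ∧ 0 < W.Pr (p, eps C M)
        (evInfOften (inLoc A) ∩ evAlways (fun s : Conf Q C M => s.1 ∉ B))}})
      (fun ω hω _ => hω)
    refine Scheduler.exists_finiteMemory_of_reach _ _ ?_ ?_ n V _ (fun _ => rfl) hn
    · rintro s ω ⟨h1, m, hm⟩
      refine ⟨fun k => ?_, m + 1, ?_⟩
      · obtain ⟨i, hi, hA⟩ := h1 k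
        exact ⟨i + 1, by omega, hA⟩
      · rintro (_ | i) hi
        · omega
        · exact hm i (by omega)
    · rintro p ⟨W, hW, hp⟩
      refine ⟨W, hW, hp.trans_le (W.Pr_mono _ ?_)⟩
      rintro ω ⟨h1, h2⟩ -
      exact ⟨h1, 0, fun i _ => h2 i⟩

end NPLCSmodel
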